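/- arXiv:2011.13543 — 4 statements merged into one kernel-verified Lean document; each statement's English description precedes it below -/
import Mathlib

section
/- Let F ∈ 𝓕₁(I) be strictly increasing and let f ∈ 𝓕(I) be a strictly decreasing multifunction with f²(x) = F(x) for all x ∈ I. Then f maps the union of the subintervals in Λ(F) into itself; more precisely, for each subinterval I' ∈ Λ(F) there exists J' ∈ Λ(F) such that f(I') ⊆ J' and f(J') ⊆ I'. In particular, if f(I') ⊆ I' then one may take J' = I'. -/
open Set Filter Topology

/-- Iterates of a multifunction: `Iter F 0 x = {x}`, `Iter F (n+1) x = F (Iter F n x)`. -/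
def Iter (F : ℝ → Set ℝ) : ℕ → ℝ → Set ℝ
  | 0 => fun x => {x}
  | n + 1 => fun x => ⋃ y ∈ Iter F n x, F y

/-- Composition of multifunctions: `(G ∘ F)(x) = ⋃ y ∈ F x, G y`. -/
def Comp (G F : ℝ → Set ℝ) : ℝ → Set ℝ := fun x => ⋃ y ∈ F x, G y

/-- Image of a set under a multifunction: `F(A) = ⋃ x ∈ A, F x`. -/
def ImageOf (F : ℝ → Set ℝ) (A : Set ℝ) : Set ℝ := ⋃ x ∈ A, F x

/-- `F` is a multifunction on `[a,b]`: nonempty compact values contained in `[a,b]`. -/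
def MFOn (a b : ℝ) (F : ℝ → Set ℝ) : Prop :=
  ∀ x ∈ Icc a b, (F x).Nonempty ∧ IsCompact (F x) ∧ F x ⊆ Icc a b

/-- Upper semicontinuity of a multifunction at a point, relative to a domain `S`. -/
def USCWithin (S : Set ℝ) (F : ℝ → Set ℝ) (x : ℝ) : Prop :=
  ∀ V : Set ℝ, IsOpen V → F x ⊆ V → ∃ U ∈ 𝓝 x, ∀ y ∈ U ∩ S, F y ⊆ V

/-- Upper semicontinuity on `[a,b]`. -/
def USCOn (a b : ℝ) (F : ℝ → Set ℝ) : Prop :=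
  ∀ x ∈ Icc a b, USCWithin (Icc a b) F x

/-- Strictly increasing multifunction: `max F(x) < min F(y)` whenever `x < y` in `[a,b]`. -/
def SIncOn (a b : ℝ) (F : ℝ → Set ℝ) : Prop :=
  ∀ x ∈ Icc a b, ∀ y ∈ Icc a b, x < y → ∀ u ∈ F x, ∀ v ∈ F y, u < v

/-- Strictly decreasing multifunction: `min F(x) > max F(y)` whenever `x < y` in `[a,b]`. -/
def SDecOn (a b : ℝ) (F : ℝ → Set ℝ) : Prop :=
  ∀ x ∈ Icc a b, ∀ y ∈ Icc a b, x < y → ∀ u ∈ F x, ∀ v ∈ F y, v < u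

/-- The class 𝓕(I) of strictly monotone usc multifunctions on `I = [a,b]`. -/
def ClassF (a b : ℝ) (F : ℝ → Set ℝ) : Prop :=
  MFOn a b F ∧ USCOn a b F ∧ (SIncOn a b F ∨ SDecOn a b F)

/-- The set `J(F)` of jumps (set-valued points) of `F` in `[a,b]`. -/
def Jumps (a b : ℝ) (F : ℝ → Set ℝ) : Set ℝ :=
  {x | x ∈ Icc a b ∧ (F x).Nontrivial}

/-- `k` is the intensity `ζ(F)`: the least `k` with `#J(F^k) = #J(F^{k+1})`. -/
def IsIntensity (a b : ℝ) (F : ℝ → Set ℝ) (k : ℕ) : Prop :=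
  IsLeast {j : ℕ | (Jumps a b (Iter F j)).ncard = (Jumps a b (Iter F (j + 1))).ncard} k

/-- Exclusive multifunctions 𝓕₁(I): members of 𝓕(I) with finitely many jumps and intensity 1. -/
def Exclusive (a b : ℝ) (F : ℝ → Set ℝ) : Prop :=
  ClassF a b F ∧ (Jumps a b F).Finite ∧ IsIntensity a b F 1

/-- Enumeration of the jumps: `c 0 = a`, `c (m+1) = b`, `c` strictly increasing on `{0,…,m+1}`,
and the jumps of `F` are exactly `c 1 < … < c m`.  The subintervals are `I_i = (c i, c (i+1))`. -/
def JumpEnum (a b : ℝ) (F : ℝ → Set ℝ) (m : ℕ) (c : ℕ → ℝ) : Prop :=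
  c 0 = a ∧ c (m + 1) = b ∧ (∀ i j : ℕ, i < j → j ≤ m + 1 → c i < c j) ∧
    Jumps a b F = {x | ∃ i : ℕ, 1 ≤ i ∧ i ≤ m ∧ x = c i}

/-- Hypothesis (H): `F` is strictly increasing, `max F(x) < x` on `(a,b)`, and `max F(b) ≤ b`. -/
def HypH (a b : ℝ) (F : ℝ → Set ℝ) : Prop :=
  SIncOn a b F ∧ (∀ x ∈ Ioo a b, ∀ u ∈ F x, u < x) ∧ (∀ u ∈ F b, u ≤ b)

/-- Distinct points have disjoint values under a strictly monotone multifunction. -/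
theorem ClassF.eq_of_mem_of_mem {a b : ℝ} {G : ℝ → Set ℝ} (hG : ClassF a b G) {x y u : ℝ}
    (hx : x ∈ Icc a b) (hy : y ∈ Icc a b) (hux : u ∈ G x) (huy : u ∈ G y) : x = y := by
  rcases lt_trichotomy x y with h | h | h
  · rcases hG.2.2 with hm | hm
    · exact absurd (hm x hx y hy h u hux u huy) (lt_irrefl u)
    · exact absurd (hm x hx y hy h u hux u huy) (lt_irrefl u)
  · exact h
  · rcases hG.2.2 with hm | hm
    · exact absurd (hm y hy x hx h u huy u hux) (lt_irrefl u)
    · exact absurd (hm y hy x hx h u huy u hux) (lt_irrefl u)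

theorem mem_iter_two {G : ℝ → Set ℝ} {x u : ℝ} :
    u ∈ Iter G 2 x ↔ ∃ y ∈ G x, u ∈ G y := by
  simp [Iter]

theorem jumps_subset_jumps_iter_two {a b : ℝ} {G : ℝ → Set ℝ} (hG : ClassF a b G) :
    Jumps a b G ⊆ Jumps a b (Iter G 2) := by
  rintro x ⟨hx, y, hy, z, hz, hyz⟩
  have hy' := (hG.1 x hx).2.2 hy
  have hz' := (hG.1 x hx).2.2 hz
  obtain ⟨u, hu⟩ := (hG.1 y hy').1
  obtain ⟨v, hv⟩ := (hG.1 z hz').1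
  refine ⟨hx, u, mem_iter_two.2 ⟨y, hy, hu⟩, v, mem_iter_two.2 ⟨z, hz, hv⟩, ?_⟩
  rintro rfl
  exact hyz (hG.eq_of_mem_of_mem hy' hz' hu hv)

theorem Exclusive.jumps_iter_two {a b : ℝ} {F : ℝ → Set ℝ} (hF : Exclusive a b F) :
    Jumps a b (Iter F 2) = Jumps a b F := by
  obtain ⟨hcl, -, hint, hleast⟩ := hF
  have h1 : Iter F 1 = F := by
    funext x
    simp [Iter]
  have h0 : Jumps a b (Iter F 0) = ∅ := by
    ext x
    simp [Jumps, Iter]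
  simp only [mem_ofPred_eq, h1] at hint
  have hne : (Jumps a b F).ncard ≠ 0 := fun h => by
    have : (0 : ℕ) ∈ {j : ℕ | (Jumps a b (Iter F j)).ncard =
        (Jumps a b (Iter F (j + 1))).ncard} := by
      simp [h0, h1, h]
    exact absurd (hleast this) (by norm_num)
  have hfin : (Jumps a b (Iter F 2)).Finite :=
    Set.finite_of_ncard_ne_zero (fun h => hne (hint.trans h))
  exact (Set.eq_of_subset_of_ncard_le (jumps_subset_jumps_iter_two hcl) hint.ge hfin).symm

/-- An exclusive multifunction maps non-jumps to non-jumps. -/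
theorem Exclusive.notMem_jumps {a b : ℝ} {F : ℝ → Set ℝ} (hF : Exclusive a b F) {x y : ℝ}
    (hx : x ∈ Icc a b) (hxJ : x ∉ Jumps a b F) (hy : y ∈ F x) : y ∉ Jumps a b F := by
  rintro ⟨-, u, hu, v, hv, huv⟩
  refine hxJ (hF.jumps_iter_two ▸ ⟨hx, u, ?_, v, ?_, huv⟩)
  · exact mem_iter_two.2 ⟨y, hy, hu⟩
  · exact mem_iter_two.2 ⟨y, hy, hv⟩

theorem JumpEnum.le {a b : ℝ} {F : ℝ → Set ℝ} {m : ℕ} {c : ℕ → ℝ} (hc : JumpEnum a b F m c)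
    {i j : ℕ} (hij : i ≤ j) (hj : j ≤ m + 1) : c i ≤ c j := by
  rcases hij.eq_or_lt with rfl | h
  · exact le_rfl
  · exact (hc.2.2.1 i j h hj).le

theorem JumpEnum.Ioo_subset {a b : ℝ} {F : ℝ → Set ℝ} {m : ℕ} {c : ℕ → ℝ}
    (hc : JumpEnum a b F m c) {i : ℕ} (hi : i ≤ m) : Ioo (c i) (c (i + 1)) ⊆ Ioo a b := by
  have h1 := hc.le (Nat.zero_le i) (by omega)
  have h2 := hc.le (show i + 1 ≤ m + 1 by omega) le_rfl
  rw [hc.1] at h1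
  rw [hc.2.1] at h2
  exact Ioo_subset_Ioo h1 h2

theorem JumpEnum.notMem_jumps {a b : ℝ} {F : ℝ → Set ℝ} {m : ℕ} {c : ℕ → ℝ}
    (hc : JumpEnum a b F m c) {i : ℕ} (hi : i ≤ m) {x : ℝ}
    (hx : x ∈ Ioo (c i) (c (i + 1))) : x ∉ Jumps a b F := by
  rw [hc.2.2.2]
  rintro ⟨k, -, hk, rfl⟩
  rcases Nat.lt_or_ge i k with h | h
  · exact (hc.le (show i + 1 ≤ k from h) (by omega)).not_gt hx.2
  · exact (hc.le h (by omega)).not_gt hx.1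

theorem JumpEnum.exists_mem_Ioo {a b : ℝ} {F : ℝ → Set ℝ} {m : ℕ} {c : ℕ → ℝ}
    (hc : JumpEnum a b F m c) {u : ℝ} (hu : u ∈ Ioo a b) (huJ : u ∉ Jumps a b F) :
    ∃ j ≤ m, u ∈ Ioo (c j) (c (j + 1)) := by
  classical
  have hex : ∃ k, k ≤ m + 1 ∧ u < c k := ⟨m + 1, le_rfl, hc.2.1 ▸ hu.2⟩
  obtain ⟨hle, hlt⟩ := Nat.find_spec hex
  have hmin := fun k => Nat.find_min hex (m := k)
  generalize Nat.find hex = n at hle hlt hmin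
  cases n with
  | zero => exact absurd (hc.1 ▸ hlt) hu.1.not_gt
  | succ k =>
    refine ⟨k, by omega, lt_of_le_of_ne ?_ ?_, hlt⟩
    · exact not_lt.1 fun h => hmin k (Nat.lt_succ_self k) ⟨by omega, h⟩
    · rintro rfl
      rcases Nat.eq_zero_or_pos k with rfl | hpos
      · exact hu.1.ne hc.1.symm
      · exact huJ (hc.2.2.2 ▸ ⟨k, hpos, by omega, rfl⟩)

/-- A strictly monotone multifunction does not attain `a` or `b` at interior points. -/
theorem ClassF.mem_Ioo {a b : ℝ} {G : ℝ → Set ℝ} (hG : ClassF a b G) {x u : ℝ}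
    (hx : x ∈ Ioo a b) (hu : u ∈ G x) : u ∈ Ioo a b := by
  have hab : a ≤ b := (hx.1.trans hx.2).le
  have ha := left_mem_Icc.2 hab
  have hb := right_mem_Icc.2 hab
  have hx' := Ioo_subset_Icc_self hx
  obtain ⟨p, hp⟩ := (hG.1 a ha).1
  obtain ⟨q, hq⟩ := (hG.1 b hb).1
  have hp' := (hG.1 a ha).2.2 hp
  have hq' := (hG.1 b hb).2.2 hq
  rcases hG.2.2 with hm | hm
  · exact ⟨hp'.1.trans_lt (hm a ha x hx' hx.1 p hp u hu),
      (hm x hx' b hb hx.2 u hu q hq).trans_le hq'.2⟩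
  · exact ⟨hq'.1.trans_lt (hm x hx' b hb hx.2 u hu q hq),
      (hm a ha x hx' hx.1 p hp u hu).trans_le hp'.2⟩

theorem ClassF.isPreconnected_imageOf {a b : ℝ} {G : ℝ → Set ℝ} (hG : ClassF a b G)
    {S : Set ℝ} (hS : IsPreconnected S) (hSI : S ⊆ Icc a b)
    (hsub : ∀ x ∈ S, (G x).Subsingleton) : IsPreconnected (ImageOf G S) := by
  choose! h hh using fun x (hx : x ∈ S) => (hG.1 x (hSI hx)).1
  have hval : ∀ x ∈ S, G x = {h x} := fun x hx =>
    (hsub x hx).eq_singleton_of_mem (hh x hx)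
  have himg : ImageOf G S = h '' S := by
    ext u
    simp only [ImageOf, mem_iUnion, mem_image, exists_prop]
    refine exists_congr fun x => and_congr_right fun hx => ?_
    rw [hval x hx, mem_singleton_iff, eq_comm]
  rw [himg]
  refine hS.image h fun x hx => ?_
  rw [ContinuousWithinAt, tendsto_nhds]
  intro V hV hxV
  obtain ⟨U, hU, hUV⟩ := hG.2.1 x (hSI hx) V hV (by rw [hval x hx]; simpa using hxV)
  filter_upwards [mem_nhdsWithin_of_mem_nhds hU, self_mem_nhdsWithin] with y hyU hyS
  exact hUV y ⟨hyU, hSI hyS⟩ (hh y hyS)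

/-- If `G` is single-valued on a subinterval determined by the jumps of `F` and takes no jump
of `F` as a value there, then it maps this subinterval into every subinterval that it meets. -/
theorem ClassF.imageOf_Ioo_subset {a b : ℝ} {F G : ℝ → Set ℝ} {m : ℕ} {c : ℕ → ℝ}
    (hc : JumpEnum a b F m c) (hG : ClassF a b G) {i j : ℕ} (hi : i ≤ m) (hj : j ≤ m)
    (hsub : ∀ x ∈ Ioo (c i) (c (i + 1)), (G x).Subsingleton)
    (hJ : ∀ x ∈ Ioo (c i) (c (i + 1)), ∀ u ∈ G x, u ∉ Jumps a b F)
    {u : ℝ} (hu : u ∈ ImageOf G (Ioo (c i) (c (i + 1)))) (huj : u ∈ Ioo (c j) (c (j + 1))) :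
    ImageOf G (Ioo (c i) (c (i + 1))) ⊆ Ioo (c j) (c (j + 1)) := by
  have hconn : OrdConnected (ImageOf G (Ioo (c i) (c (i + 1)))) :=
    (hG.isPreconnected_imageOf isPreconnected_Ioo
      ((hc.Ioo_subset hi).trans Ioo_subset_Icc_self) hsub).ordConnected
  have hnot : ∀ k ≤ m + 1, c k ∉ ImageOf G (Ioo (c i) (c (i + 1))) := by
    intro k hk hmem
    simp only [ImageOf, mem_iUnion, exists_prop] at hmem
    obtain ⟨x, hx, hkx⟩ := hmem
    have hIoo := hG.mem_Ioo (hc.Ioo_subset hi hx) hkx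
    rcases Nat.eq_zero_or_pos k with rfl | hpos
    · exact hIoo.1.ne hc.1.symm
    rcases hk.eq_or_lt with rfl | hlt
    · exact hIoo.2.ne hc.2.1
    · exact hJ x hx _ hkx (hc.2.2.2 ▸ ⟨k, hpos, by omega, rfl⟩)
  intro v hv
  constructor
  · by_contra! h
    exact hnot j (by omega) (hconn.out hv hu ⟨h, huj.1.le⟩)
  · by_contra! h
    exact hnot (j + 1) (by omega) (hconn.out hu hv ⟨huj.2.le, h⟩)

theorem mem_imageOf {G : ℝ → Set ℝ} {S : Set ℝ} {u : ℝ} :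
    u ∈ ImageOf G S ↔ ∃ x ∈ S, u ∈ G x := by
  simp [ImageOf]

/-- a strictly decreasing square iterative root `f ∈ 𝓕(I)` of a strictly
increasing `F ∈ 𝓕₁(I)` maps the union of the subintervals in `Λ(F)` into itself; more
precisely, each `I' ∈ Λ(F)` admits `J' ∈ Λ(F)` with `f(I') ⊆ J'` and `f(J') ⊆ I'`. -/
theorem stmt15 (a b : ℝ) (hab : a < b) (F : ℝ → Set ℝ) (hF : Exclusive a b F)
    (hFinc : SIncOn a b F) (m : ℕ) (c : ℕ → ℝ) (hc : JumpEnum a b F m c)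
    (f : ℝ → Set ℝ) (hf : ClassF a b f) (hfdec : SDecOn a b f)
    (hroot : ∀ x ∈ Icc a b, Iter f 2 x = F x) :
    (ImageOf f (⋃ i ∈ {i : ℕ | i ≤ m ∧
        ImageOf F (Ioo (c i) (c (i + 1))) ⊆ Ioo (c i) (c (i + 1))},
        Ioo (c i) (c (i + 1))) ⊆
      ⋃ i ∈ {i : ℕ | i ≤ m ∧
        ImageOf F (Ioo (c i) (c (i + 1))) ⊆ Ioo (c i) (c (i + 1))},
        Ioo (c i) (c (i + 1))) ∧
    ∀ i ≤ m, ImageOf F (Ioo (c i) (c (i + 1))) ⊆ Ioo (c i) (c (i + 1)) →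
      ∃ j ≤ m, ImageOf F (Ioo (c j) (c (j + 1))) ⊆ Ioo (c j) (c (j + 1)) ∧
        ImageOf f (Ioo (c i) (c (i + 1))) ⊆ Ioo (c j) (c (j + 1)) ∧
        ImageOf f (Ioo (c j) (c (j + 1))) ⊆ Ioo (c i) (c (i + 1)) := by
  have hJf : Jumps a b f ⊆ Jumps a b F := fun x hx => by
    obtain ⟨hxI, h⟩ := jumps_subset_jumps_iter_two hf hx
    exact ⟨hxI, hroot x hxI ▸ h⟩
  have hmemI : ∀ {i : ℕ}, i ≤ m → ∀ {x : ℝ}, x ∈ Ioo (c i) (c (i + 1)) → x ∈ Icc a b :=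
    fun hi _ hx => Ioo_subset_Icc_self (hc.Ioo_subset hi hx)
  have hmemF : ∀ {x y u : ℝ}, x ∈ Icc a b → y ∈ f x → u ∈ f y → u ∈ F x :=
    fun hx hy hu => hroot _ hx ▸ mem_iter_two.2 ⟨_, hy, hu⟩
  have hfsub : ∀ i ≤ m, ∀ x ∈ Ioo (c i) (c (i + 1)), (f x).Subsingleton := fun i hi x hx =>
    not_nontrivial_iff.1 fun h => hc.notMem_jumps hi hx (hJf ⟨hmemI hi hx, h⟩)
  have hFsub : ∀ i ≤ m, ∀ x ∈ Ioo (c i) (c (i + 1)), (F x).Subsingleton := fun i hi x hx =>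
    not_nontrivial_iff.1 fun h => hc.notMem_jumps hi hx ⟨hmemI hi hx, h⟩
  have hfJ : ∀ i ≤ m, ImageOf F (Ioo (c i) (c (i + 1))) ⊆ Ioo (c i) (c (i + 1)) →
      ∀ x ∈ Ioo (c i) (c (i + 1)), ∀ u ∈ f x, u ∉ Jumps a b F := by
    rintro i hi hΛ x hx y hy ⟨hyI, p, hp, q, hq, hpq⟩
    rw [← hroot y hyI, mem_iter_two] at hp hq
    obtain ⟨w, hw, hpw⟩ := hp
    obtain ⟨z, hz, hqz⟩ := hq
    have hwF := hmemF (hmemI hi hx) hy hw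
    obtain rfl := hFsub i hi x hx hwF (hmemF (hmemI hi hx) hy hz)
    exact hpq (hfsub i hi w (hΛ (mem_imageOf.2 ⟨x, hx, hwF⟩)) hpw hqz)
  have main : ∀ i ≤ m, ImageOf F (Ioo (c i) (c (i + 1))) ⊆ Ioo (c i) (c (i + 1)) →
      ∃ j ≤ m, ImageOf F (Ioo (c j) (c (j + 1))) ⊆ Ioo (c j) (c (j + 1)) ∧
        ImageOf f (Ioo (c i) (c (i + 1))) ⊆ Ioo (c j) (c (j + 1)) ∧
        ImageOf f (Ioo (c j) (c (j + 1))) ⊆ Ioo (c i) (c (i + 1)) := by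
    intro i hi hΛ
    obtain ⟨x, hx⟩ : (Ioo (c i) (c (i + 1))).Nonempty :=
      nonempty_Ioo.2 (hc.2.2.1 i (i + 1) (by omega) (by omega))
    obtain ⟨y, hy⟩ := (hf.1 x (hmemI hi hx)).1
    obtain ⟨j, hj, hyj⟩ := hc.exists_mem_Ioo (hf.mem_Ioo (hc.Ioo_subset hi hx) hy)
      (hfJ i hi hΛ x hx y hy)
    have hij := hf.imageOf_Ioo_subset hc hi hj (hfsub i hi) (hfJ i hi hΛ)
      (mem_imageOf.2 ⟨x, hx, hy⟩) hyj
    obtain ⟨z, hz⟩ := (hf.1 y (hmemI hj hyj)).1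
    have hzi : z ∈ Ioo (c i) (c (i + 1)) :=
      hΛ (mem_imageOf.2 ⟨x, hx, hmemF (hmemI hi hx) hy hz⟩)
    obtain ⟨w, hw⟩ := (hf.1 z (hmemI hi hzi)).1
    have hjΛ := hF.1.imageOf_Ioo_subset hc hj hj (hFsub j hj)
      (fun t ht u hu => hF.notMem_jumps (hmemI hj ht) (hc.notMem_jumps hj ht) hu)
      (mem_imageOf.2 ⟨y, hyj, hmemF (hmemI hj hyj) hz hw⟩)
      (hij (mem_imageOf.2 ⟨z, hzi, hw⟩))
    exact ⟨j, hj, hjΛ, hij, hf.imageOf_Ioo_subset hc hj hi (hfsub j hj) (hfJ j hj hjΛ)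
      (mem_imageOf.2 ⟨y, hyj, hz⟩) hzi⟩
  refine ⟨fun u hu => ?_, main⟩
  obtain ⟨x, hx, hux⟩ := mem_imageOf.1 hu
  simp only [mem_iUnion, mem_ofPred_eq, exists_prop] at hx ⊢
  obtain ⟨i, ⟨hi, hΛ⟩, hxi⟩ := hx
  obtain ⟨j, hj, hjΛ, hij, -⟩ := main i hi hΛ
  exact ⟨j, ⟨hj, hjΛ⟩, hij (mem_imageOf.2 ⟨x, hxi, hux⟩)⟩
end

section
/- Suppose F ∈ 𝓕₁(I) is strictly increasing, c_i ∈ J(F) satisfies J(F) ∩ F(c_i) = {c_i} (case J2), and F(c_i) is a compact interval. Let f^* : I ∖ J(F) → I ∖ J(F) be a strictly decreasing continuous single-valued function with (f^*)²(x) = F(x) (a singleton) for all x ∈ I ∖ J(F), and assume J(F) ∩ (lim_{x→c_i⁺} f^*(x), lim_{x→c_i⁻} f^*(x)) = {c_i}. Then the multifunction f defined by f(x) = {f^*(x)} for x ∈ I ∖ J(F) and f(c_i) = [lim_{x→c_i⁺} f^*(x), lim_{x→c_i⁻} f^*(x)] is a strictly decreasing upper semi-continuous square iterative root of F on (I ∖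 J(F)) ∪ {c_i}; in particular f²(c_i) = [lim_{x→c_i⁻} F(x), lim_{x→c_i⁺} F(x)] = F(c_i). -/
open Set Filter Topology

/-- The complement of a finite set in `[a,b]` is a punctured left neighborhood of any point of
`(a,b]`. -/
theorem diff_finite_mem_nhdsLT {a b c : ℝ} {J : Set ℝ} (hJ : J.Finite) (hac : a < c)
    (hcb : c ≤ b) : Icc a b \ J ∈ 𝓝[<] c := by
  have h1 : (J \ {c})ᶜ ∈ 𝓝 c := (hJ.subset sdiff_subset).isClosed.isOpen_compl.mem_nhds (by simp)
  filter_upwards [mem_nhdsWithin_of_mem_nhds h1, Ioo_mem_nhdsLT hac] with x hx hxc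
  exact ⟨⟨hxc.1.le, hxc.2.le.trans hcb⟩, fun hxJ => hx ⟨hxJ, hxc.2.ne⟩⟩

/-- The complement of a finite set in `[a,b]` is a punctured right neighborhood of any point of
`[a,b)`. -/
theorem diff_finite_mem_nhdsGT {a b c : ℝ} {J : Set ℝ} (hJ : J.Finite) (hac : a ≤ c)
    (hcb : c < b) : Icc a b \ J ∈ 𝓝[>] c := by
  have h1 : (J \ {c})ᶜ ∈ 𝓝 c := (hJ.subset sdiff_subset).isClosed.isOpen_compl.mem_nhds (by simp)
  filter_upwards [mem_nhdsWithin_of_mem_nhds h1, Ioo_mem_nhdsGT hcb] with x hx hxc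
  exact ⟨⟨hac.trans hxc.1.le, hxc.2.le⟩, fun hxJ => hx ⟨hxJ, hxc.1.ne'⟩⟩

/-- A strictly decreasing function stays strictly above its left limit. -/
theorem StrictAntiOn.lt_of_tendsto_nhdsLT {f : ℝ → ℝ} {S : Set ℝ} {c L x : ℝ}
    (hf : StrictAntiOn f S) (hS : S ∈ 𝓝[<] c) (hL : Tendsto f (𝓝[<] c) (𝓝 L)) (hx : x ∈ S)
    (hxc : x < c) : L < f x := by
  obtain ⟨y, hyS, hxy, hyc⟩ := (inter_mem hS (Ioo_mem_nhdsLT hxc) |> Filter.nonempty_of_mem)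
  refine (le_of_tendsto hL ?_).trans_lt (hf hx hyS hxy)
  filter_upwards [hS, Ioo_mem_nhdsLT hyc] with z hz hyz
  exact (hf hyS hz hyz.1).le

/-- A strictly decreasing function stays strictly below its right limit. -/
theorem StrictAntiOn.lt_of_tendsto_nhdsGT {f : ℝ → ℝ} {S : Set ℝ} {c L x : ℝ}
    (hf : StrictAntiOn f S) (hS : S ∈ 𝓝[>] c) (hL : Tendsto f (𝓝[>] c) (𝓝 L)) (hx : x ∈ S)
    (hcx : c < x) : f x < L := by
  obtain ⟨y, hyS, hcy, hyx⟩ := (inter_mem hS (Ioo_mem_nhdsGT hcx) |> Filter.nonempty_of_mem)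
  refine (hf hyS hx hyx).trans_le (ge_of_tendsto hL ?_)
  filter_upwards [hS, Ioo_mem_nhdsGT hcy] with z hz hyz
  exact (hf hz hyS hyz.2).le

theorem Iter_two (f : ℝ → Set ℝ) (x : ℝ) : Iter f 2 x = ⋃ y ∈ f x, f y := by
  simp [Iter]

/-- case (J2) for decreasing square roots.  If `f^*` is a strictly decreasing
continuous square iterative root of `F` on `I ∖ J(F)` and the open interval between the
one-sided limits of `f^*` at `cᵢ` contains exactly the jump `cᵢ`, then setting `f = f^*` off
the jumps and `f(cᵢ) = [lim_{x→cᵢ⁺} f^*(x), lim_{x→cᵢ⁻} f^*(x)]` yields a strictly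
decreasing usc square iterative root of `F` on `(I ∖ J(F)) ∪ {cᵢ}`; in particular
`f²(cᵢ) = [lim_{x→cᵢ⁻} F(x), lim_{x→cᵢ⁺} F(x)] = F(cᵢ)`. -/
theorem stmt17 (a b : ℝ) (hab : a < b) (F : ℝ → Set ℝ) (hF : Exclusive a b F)
    (hFinc : SIncOn a b F)
    (ci : ℝ) (hci : ci ∈ Jumps a b F) (hJ2 : Jumps a b F ∩ F ci = {ci})
    (hcpt : ∃ p q : ℝ, p ≤ q ∧ F ci = Icc p q)
    (fs : ℝ → ℝ)
    (hmaps : MapsTo fs (Icc a b \ Jumps a b F) (Icc a b \ Jumps a b F))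
    (hanti : StrictAntiOn fs (Icc a b \ Jumps a b F))
    (hcont : ContinuousOn fs (Icc a b \ Jumps a b F))
    (hroot : ∀ x ∈ Icc a b \ Jumps a b F, F x = {fs (fs x)})
    (Lp Lm : ℝ)
    (hLp : Tendsto fs (𝓝[(Icc a b \ Jumps a b F) ∩ Ioi ci] ci) (𝓝 Lp))
    (hLm : Tendsto fs (𝓝[(Icc a b \ Jumps a b F) ∩ Iio ci] ci) (𝓝 Lm))
    (hcond : Jumps a b F ∩ Ioo Lp Lm = {ci})
    (M1 M2 : ℝ)
    (hM1 : Tendsto (fun x => fs (fs x)) (𝓝[(Icc a b \ Jumps a b F) ∩ Iio ci] ci) (𝓝 M1))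
    (hM2 : Tendsto (fun x => fs (fs x)) (𝓝[(Icc a b \ Jumps a b F) ∩ Ioi ci] ci) (𝓝 M2))
    (f : ℝ → Set ℝ)
    (hfdef : ∀ x ∈ Icc a b \ Jumps a b F, f x = {fs x})
    (hfci : f ci = Icc Lp Lm) :
    (∀ x ∈ insert ci (Icc a b \ Jumps a b F), Iter f 2 x = F x) ∧
    (∀ x ∈ insert ci (Icc a b \ Jumps a b F),
      ∀ y ∈ insert ci (Icc a b \ Jumps a b F),
        x < y → ∀ u ∈ f x, ∀ v ∈ f y, v < u) ∧
    (∀ x ∈ insert ci (Icc a b \ Jumps a b F),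
      USCWithin (insert ci (Icc a b \ Jumps a b F)) f x) ∧
    Iter f 2 ci = Icc M1 M2 ∧ Icc M1 M2 = F ci := by
  obtain ⟨⟨-, husc, -⟩, hJfin, -⟩ := hF
  obtain ⟨p, q, hpq, hFci⟩ := hcpt
  have hciI := hci.1
  obtain ⟨-, hLpc, hcLm⟩ : ci ∈ Jumps a b F ∩ Ioo Lp Lm := hcond ▸ mem_singleton ci
  have hJF : ∀ y ∈ Jumps a b F, y ∈ Icc p q → y = ci := fun y hy hy' => by
    have : y ∈ Jumps a b F ∩ F ci := ⟨hy, hFci ▸ hy'⟩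
    rwa [hJ2] at this
  set S := Icc a b \ Jumps a b F with hS
  have hcS : ci ∉ S := fun h => h.2 hci
  have hfI : ∀ x ∈ S, fs x ∈ Icc a b := fun x hx => (hmaps hx).1
  have hcb : ci < b := by
    refine hciI.2.lt_of_ne fun h => ?_
    have hSl : S ∈ 𝓝[<] ci := diff_finite_mem_nhdsLT hJfin (h ▸ hab) hciI.2
    rw [nhdsWithin_inter_of_mem hSl] at hLm
    have : Lm ≤ b := le_of_tendsto hLm (by filter_upwards [hSl] with x hx using (hfI x hx).2)
    linarith
  have hSr : S ∈ 𝓝[>] ci := diff_finite_mem_nhdsGT hJfin hciI.1 hcb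
  rw [nhdsWithin_inter_of_mem hSr] at hLp hM2
  have haLp : a ≤ Lp := ge_of_tendsto hLp (by filter_upwards [hSr] with x hx using (hfI x hx).1)
  have hSl : S ∈ 𝓝[<] ci := diff_finite_mem_nhdsLT hJfin (haLp.trans_lt hLpc) hciI.2
  rw [nhdsWithin_inter_of_mem hSl] at hLm hM1
  have hLmb : Lm ≤ b := le_of_tendsto hLm (by filter_upwards [hSl] with x hx using (hfI x hx).2)
  have habove : ∀ x ∈ S, x < ci → Lm < fs x := fun x hx h =>
    hanti.lt_of_tendsto_nhdsLT hSl hLm hx h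
  have hbelow : ∀ x ∈ S, ci < x → fs x < Lp := fun x hx h =>
    hanti.lt_of_tendsto_nhdsGT hSr hLp hx h
  have hpF : p ∈ F ci := hFci ▸ left_mem_Icc.2 hpq
  have hqF : q ∈ F ci := hFci ▸ right_mem_Icc.2 hpq
  have hroot' : ∀ x ∈ S, fs (fs x) ∈ F x := fun x hx => hroot x hx ▸ mem_singleton _
  have hM1p : M1 = p := by
    refine le_antisymm (le_of_tendsto hM1 ?_) (not_lt.1 fun hlt => ?_)
    · filter_upwards [hSl, self_mem_nhdsWithin] with x hx hxc
      exact (hFinc x hx.1 ci hciI hxc _ (hroot' x hx) p hpF).le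
    · obtain ⟨r, hr1, hr2⟩ := exists_between hlt
      obtain ⟨U, hU, hUV⟩ := husc ci hciI (Ioi r) isOpen_Ioi
        (fun y hy => hr2.trans_le (hFci ▸ hy : y ∈ Icc p q).1)
      refine absurd (ge_of_tendsto (b := r) hM1 ?_) (not_le.2 hr1)
      filter_upwards [hSl, mem_nhdsWithin_of_mem_nhds hU] with x hx hxU
      exact le_of_lt (hUV x ⟨hxU, hx.1⟩ (hroot' x hx))
  have hM2q : M2 = q := by
    refine le_antisymm (not_lt.1 fun hlt => ?_) (ge_of_tendsto hM2 ?_)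
    · obtain ⟨r, hr1, hr2⟩ := exists_between hlt
      obtain ⟨U, hU, hUV⟩ := husc ci hciI (Iio r) isOpen_Iio
        (fun y hy => (hFci ▸ hy : y ∈ Icc p q).2.trans_lt hr1)
      refine absurd (le_of_tendsto (b := r) hM2 ?_) (not_le.2 hr2)
      filter_upwards [hSr, mem_nhdsWithin_of_mem_nhds hU] with x hx hxU
      exact le_of_lt (hUV x ⟨hxU, hx.1⟩ (hroot' x hx))
    · filter_upwards [hSr, self_mem_nhdsWithin] with x hx hxc
      exact (hFinc ci hciI x hx.1 hxc q hqF _ (hroot' x hx)).le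
  subst hM1p hM2q
  have hM1Lp : M1 ≤ Lp := by
    refine le_of_tendsto hM1 ?_
    filter_upwards [hSl, self_mem_nhdsWithin] with x hx hxc
    exact (hbelow _ (hmaps hx) (hcLm.trans (habove x hx hxc))).le
  have hLmM2 : Lm ≤ M2 := by
    refine ge_of_tendsto hM2 ?_
    filter_upwards [hSr, self_mem_nhdsWithin] with x hx hxc
    exact (habove _ (hmaps hx) ((hbelow x hx hxc).trans hLpc)).le
  have hmemS : ∀ y ∈ Icc Lp Lm, y ≠ ci → y ∈ S := fun y hy hne =>
    ⟨⟨haLp.trans hy.1, hy.2.trans hLmb⟩,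
      fun hyJ => hne (hJF y hyJ ⟨hM1Lp.trans hy.1, hy.2.trans hLmM2⟩)⟩
  have hLL : Lp ≤ Lm := (hLpc.trans hcLm).le
  have hLmS : Lm ∈ S := hmemS Lm (right_mem_Icc.2 hLL) hcLm.ne'
  have hLpS : Lp ∈ S := hmemS Lp (left_mem_Icc.2 hLL) hLpc.ne
  have hfLm : fs Lm = M1 :=
    tendsto_nhds_unique ((hcont Lm hLmS).tendsto.comp (tendsto_nhdsWithin_iff.2
      ⟨hLm, by filter_upwards [hSl] with x hx using hmaps hx⟩)) hM1
  have hfLp : fs Lp = M2 :=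
    tendsto_nhds_unique ((hcont Lp hLpS).tendsto.comp (tendsto_nhdsWithin_iff.2
      ⟨hLp, by filter_upwards [hSr] with x hx using hmaps hx⟩)) hM2
  have hiter : Iter f 2 ci = Icc M1 M2 := by
    rw [Iter_two, hfci]
    ext w
    simp only [mem_iUnion, exists_prop]
    constructor
    · rintro ⟨y, hy, hw⟩
      rcases eq_or_ne y ci with rfl | hne
      · rw [hfci] at hw
        exact ⟨hM1Lp.trans hw.1, hw.2.trans hLmM2⟩
      · have hyS := hmemS y hy hne
        rw [hfdef y hyS, mem_singleton_iff] at hw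
        rw [hw, ← hfLm, ← hfLp]
        exact ⟨hanti.antitoneOn hyS hLmS hy.2, hanti.antitoneOn hLpS hyS hy.1⟩
    · rintro ⟨hw1, hw2⟩
      rcases lt_or_ge w Lp with hwp | hwp
      · obtain ⟨z, hwz, hcz, hzL⟩ := Filter.nonempty_of_mem
          (inter_mem (hLp.eventually (lt_mem_nhds hwp)) (Ioo_mem_nhdsGT hcLm))
        have hsub : Icc z Lm ⊆ S := fun y hy =>
          hmemS y ⟨(hLpc.trans hcz).le.trans hy.1, hy.2⟩ (hcz.trans_le hy.1).ne'
        obtain ⟨y, hy, rfl⟩ := intermediate_value_Icc' hzL.le (hcont.mono hsub)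
          ⟨hfLm ▸ hw1, le_of_lt hwz⟩
        refine ⟨y, ⟨(hLpc.trans hcz).le.trans hy.1, hy.2⟩, ?_⟩
        simp [hfdef y (hsub hy)]
      rcases le_or_gt w Lm with hwm | hwm
      · exact ⟨ci, ⟨hLpc.le, hcLm.le⟩, hfci ▸ ⟨hwp, hwm⟩⟩
      · obtain ⟨z, hwz, hLz, hzc⟩ := Filter.nonempty_of_mem
          (inter_mem (hLm.eventually (gt_mem_nhds hwm)) (Ioo_mem_nhdsLT hLpc))
        have hsub : Icc Lp z ⊆ S := fun y hy =>
          hmemS y ⟨hy.1, hy.2.trans (hzc.trans hcLm).le⟩ (hy.2.trans_lt hzc).ne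
        obtain ⟨y, hy, rfl⟩ := intermediate_value_Icc' hLz.le (hcont.mono hsub)
          ⟨le_of_lt hwz, hfLp ▸ hw2⟩
        refine ⟨y, ⟨hy.1, hy.2.trans (hzc.trans hcLm).le⟩, ?_⟩
        simp [hfdef y (hsub hy)]
  refine ⟨?_, ?_, ?_, hiter, hFci.symm⟩
  · rintro x (rfl | hx)
    · rw [hiter, hFci]
    · rw [Iter_two, hfdef x hx, biUnion_singleton, hfdef _ (hmaps hx), hroot x hx]
  · rintro x (rfl | hx) y (rfl | hy) hxy u hu v hv
    · exact absurd hxy (lt_irrefl _)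
    · rw [hfci] at hu
      rw [hfdef y hy, mem_singleton_iff] at hv
      exact hv ▸ (hbelow y hy hxy).trans_le hu.1
    · rw [hfci] at hv
      rw [hfdef x hx, mem_singleton_iff] at hu
      exact hu ▸ hv.2.trans_lt (habove x hx hxy)
    · rw [hfdef x hx, mem_singleton_iff] at hu
      rw [hfdef y hy, mem_singleton_iff] at hv
      exact hu ▸ hv ▸ hanti hx hy hxy
  · rintro x (rfl | hx) V hV hfV
    · rw [hfci] at hfV
      have hl := mem_nhdsWithin_iff_exists_mem_nhds_inter.1
        (hLm (hV.mem_nhds (hfV (right_mem_Icc.2 hLL))))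
      have hr := mem_nhdsWithin_iff_exists_mem_nhds_inter.1
        (hLp (hV.mem_nhds (hfV (left_mem_Icc.2 hLL))))
      obtain ⟨U, hU, hUV⟩ := hl
      obtain ⟨W, hW, hWV⟩ := hr
      refine ⟨U ∩ W, inter_mem hU hW, ?_⟩
      rintro y ⟨⟨hyU, hyW⟩, rfl | hy⟩
      · rwa [hfci]
      · rw [hfdef y hy, singleton_subset_iff]
        rcases lt_trichotomy y x with h | rfl | h
        · exact hUV ⟨hyU, h⟩
        · exact absurd hy hcS
        · exact hWV ⟨hyW, h⟩
    · rw [hfdef x hx, singleton_subset_iff] at hfV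
      obtain ⟨U, hU, hUV⟩ := mem_nhdsWithin_iff_exists_mem_nhds_inter.1
        (hcont x hx (hV.mem_nhds hfV))
      have hxc : x ≠ ci := fun h => hcS (h ▸ hx)
      refine ⟨U ∩ {ci}ᶜ, inter_mem hU (isOpen_compl_singleton.mem_nhds hxc), ?_⟩
      rintro y ⟨⟨hyU, hyc⟩, rfl | hy⟩
      · exact absurd rfl hyc
      · rw [hfdef y hy, singleton_subset_iff]
        exact hUV ⟨hyU, hy⟩
end

section
/- Let F ∈ 𝓕₁(I) be strictly decreasing. Then F has no strictly monotone square iterative root that is continuous on I ∖ J(F): there is no strictly monotone multifunction f on I with f²(x) = F(x) for all x ∈ I whose restriction to I ∖ J(F) is a (single-valued) continuous function. -/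
open Set Filter Topology

/-- a strictly decreasing `F ∈ 𝓕₁(I)` has no strictly monotone square
iterative root whose restriction to `I ∖ J(F)` is a single-valued continuous function. -/
theorem stmt18 (a b : ℝ) (hab : a < b) (F : ℝ → Set ℝ) (hF : Exclusive a b F)
    (hFdec : SDecOn a b F) :
    ¬ ∃ (f : ℝ → Set ℝ) (g : ℝ → ℝ), MFOn a b f ∧
      (SIncOn a b f ∨ SDecOn a b f) ∧
      (∀ x ∈ Icc a b, Iter f 2 x = F x) ∧
      (∀ x ∈ Icc a b \ Jumps a b F, f x = {g x}) ∧
      ContinuousOn g (Icc a b \ Jumps a b F) := by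
  rintro ⟨f, g, hf, hmono, hsq, -, -⟩
  have ha : a ∈ Icc a b := left_mem_Icc.2 hab.le
  have hb : b ∈ Icc a b := right_mem_Icc.2 hab.le
  obtain ⟨u, hu⟩ := (hf a ha).1
  obtain ⟨v, hv⟩ := (hf b hb).1
  have hu_mem : u ∈ Icc a b := (hf a ha).2.2 hu
  have hv_mem : v ∈ Icc a b := (hf b hb).2.2 hv
  obtain ⟨p, hp⟩ := (hf u hu_mem).1
  obtain ⟨q, hq⟩ := (hf v hv_mem).1
  have hpF : p ∈ F a := by
    rw [← hsq a ha]
    simp only [Iter, mem_iUnion, mem_singleton_iff, exists_prop]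
    exact ⟨u, ⟨a, rfl, hu⟩, hp⟩
  have hqF : q ∈ F b := by
    rw [← hsq b hb]
    simp only [Iter, mem_iUnion, mem_singleton_iff, exists_prop]
    exact ⟨v, ⟨b, rfl, hv⟩, hq⟩
  have hqp : q < p := hFdec a ha b hb hab p hpF q hqF
  rcases hmono with hinc | hdec
  · exact hqp.asymm (hinc u hu_mem v hv_mem (hinc a ha b hb hab u hu v hv) p hp q hq)
  · exact hqp.asymm (hdec v hv_mem u hu_mem (hdec a ha b hb hab u hu v hv) q hq p hp)
end

section
/- Let F ∈ 𝓕(I) have finitely many jumps with intensity ζ(F) > 1. Then F has no upper semi-continuous strictly monotone iterative root f ∈ 𝓕(I) of any order n > #J(F). In particular, if F has exactly one jump and ζ(F) > 1, then F has no upper semi-continuous strictly monotone iterative root of any order n ≥ 2. -/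
open Set Filter Topology

/-- Iterates compose: `F^(m+n) = F^n ∘ F^m`. -/
theorem Iter_add (F : ℝ → Set ℝ) (m n : ℕ) (x : ℝ) :
    Iter F (m + n) x = ⋃ y ∈ Iter F m x, Iter F n y := by
  induction n with
  | zero => simp [Iter]
  | succ n ih =>
    change ⋃ y ∈ Iter F (m + n) x, F y = ⋃ y ∈ Iter F m x, ⋃ z ∈ Iter F n y, F z
    rw [ih]
    simp only [biUnion_iUnion]

theorem Iter_one (F : ℝ → Set ℝ) (x : ℝ) : Iter F 1 x = F x := by
  simp [Iter]

theorem Iter_succ' (F : ℝ → Set ℝ) (n : ℕ) (x : ℝ) :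
    Iter F (n + 1) x = ⋃ y ∈ F x, Iter F n y := by
  rw [add_comm, Iter_add, Iter_one]

theorem MFOn.iter_nonempty_subset {a b : ℝ} {F : ℝ → Set ℝ} (hF : MFOn a b F) (n : ℕ)
    {x : ℝ} (hx : x ∈ Icc a b) : (Iter F n x).Nonempty ∧ Iter F n x ⊆ Icc a b := by
  induction n with
  | zero => simpa [Iter] using hx
  | succ n ih =>
    obtain ⟨⟨y, hy⟩, hsub⟩ := ih
    obtain ⟨z, hz⟩ := (hF y (hsub hy)).1
    exact ⟨⟨z, mem_iUnion₂.2 ⟨y, hy, hz⟩⟩,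
      iUnion₂_subset fun y hy => (hF y (hsub hy)).2.2⟩

/-- Distinct points have disjoint values under a strictly monotone multifunction. -/
theorem ClassF.eq_of_mem {a b : ℝ} {F : ℝ → Set ℝ} (hF : ClassF a b F) {x y u : ℝ}
    (hx : x ∈ Icc a b) (hy : y ∈ Icc a b) (hux : u ∈ F x) (huy : u ∈ F y) : x = y := by
  by_contra hne
  rcases hF.2.2 with h | h <;> rcases lt_or_gt_of_ne hne with hlt | hlt
  · exact lt_irrefl u (h x hx y hy hlt u hux u huy)
  · exact lt_irrefl u (h y hy x hx hlt u huy u hux)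
  · exact lt_irrefl u (h x hx y hy hlt u hux u huy)
  · exact lt_irrefl u (h y hy x hx hlt u huy u hux)

theorem ClassF.eq_of_mem_iter {a b : ℝ} {F : ℝ → Set ℝ} (hF : ClassF a b F) (n : ℕ) {x y u : ℝ}
    (hx : x ∈ Icc a b) (hy : y ∈ Icc a b) (hux : u ∈ Iter F n x) (huy : u ∈ Iter F n y) :
    x = y := by
  induction n generalizing u with
  | zero =>
    simp only [Iter, mem_singleton_iff] at hux huy
    exact hux.symm.trans huy
  | succ n ih =>
    simp only [Iter, mem_iUnion, exists_prop] at hux huy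
    obtain ⟨v, hv, huv⟩ := hux
    obtain ⟨w, hw, huw⟩ := huy
    have hvw := hF.eq_of_mem ((hF.1.iter_nonempty_subset n hx).2 hv)
      ((hF.1.iter_nonempty_subset n hy).2 hw) huv huw
    exact ih hv (hvw ▸ hw)

/-- The jumps of `F^(n+1)` are those of `F` together with the points sent by `F` to a jump
of `F^n`. -/
theorem ClassF.mem_jumps_iter_succ {a b : ℝ} {F : ℝ → Set ℝ} (hF : ClassF a b F) (n : ℕ)
    (x : ℝ) : x ∈ Jumps a b (Iter F (n + 1)) ↔
      x ∈ Jumps a b F ∨ x ∈ Icc a b ∧ ∃ y ∈ F x, y ∈ Jumps a b (Iter F n) := by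
  constructor
  · rintro ⟨hx, u, hu, v, hv, huv⟩
    rw [Iter_succ'] at hu hv
    simp only [mem_iUnion, exists_prop] at hu hv
    obtain ⟨y, hy, hu⟩ := hu
    obtain ⟨z, hz, hv⟩ := hv
    by_cases hyz : y = z
    · subst hyz
      exact Or.inr ⟨hx, y, hy, (hF.1 x hx).2.2 hy, u, hu, v, hv, huv⟩
    · exact Or.inl ⟨hx, y, hy, z, hz, hyz⟩
  · rintro (⟨hx, y, hy, z, hz, hyz⟩ | ⟨hx, y, hy, -, hnt⟩)
    · have hyI := (hF.1 x hx).2.2 hy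
      have hzI := (hF.1 x hx).2.2 hz
      obtain ⟨u, hu⟩ := (hF.1.iter_nonempty_subset n hyI).1
      obtain ⟨v, hv⟩ := (hF.1.iter_nonempty_subset n hzI).1
      refine ⟨hx, u, ?_, v, ?_, fun huv => hyz (hF.eq_of_mem_iter n hyI hzI hu (huv ▸ hv))⟩
      · rw [Iter_succ']
        exact mem_iUnion₂.2 ⟨y, hy, hu⟩
      · rw [Iter_succ']
        exact mem_iUnion₂.2 ⟨z, hz, hv⟩
    · refine ⟨hx, hnt.mono ?_⟩
      rw [Iter_succ']
      exact subset_biUnion_of_mem (u := fun y => Iter F n y) hy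

theorem jumps_iter_zero (a b : ℝ) (F : ℝ → Set ℝ) : Jumps a b (Iter F 0) = ∅ := by
  simp [Jumps, Iter]

theorem ClassF.monotone_jumps_iter {a b : ℝ} {F : ℝ → Set ℝ} (hF : ClassF a b F) :
    Monotone fun n => Jumps a b (Iter F n) := by
  refine monotone_nat_of_le_succ fun n => ?_
  induction n with
  | zero => simp [jumps_iter_zero]
  | succ n ih =>
    intro x hx
    rw [hF.mem_jumps_iter_succ] at hx ⊢
    exact hx.imp_right fun ⟨hx, y, hy, h⟩ => ⟨hx, y, hy, ih h⟩

/-- Once two consecutive iterates have the same jumps, so have all later iterates. -/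
theorem ClassF.jumps_iter_eq_of_le {a b : ℝ} {F : ℝ → Set ℝ} (hF : ClassF a b F) {j : ℕ}
    (hj : Jumps a b (Iter F j) = Jumps a b (Iter F (j + 1))) {n : ℕ} (hn : j ≤ n) :
    Jumps a b (Iter F n) = Jumps a b (Iter F j) := by
  induction n, hn using Nat.le_induction with
  | base => rfl
  | succ n hn ih =>
    ext x
    rw [hj, hF.mem_jumps_iter_succ, hF.mem_jumps_iter_succ, ih]

/-- An iterate of order exceeding its number of jumps has reached the stable jump set. -/
theorem ClassF.exists_jumps_iter_eq_succ {a b : ℝ} {F : ℝ → Set ℝ} (hF : ClassF a b F) {n : ℕ}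
    (hfin : (Jumps a b (Iter F n)).Finite) (hn : (Jumps a b (Iter F n)).ncard < n) :
    ∃ j < n, Jumps a b (Iter F j) = Jumps a b (Iter F (j + 1)) := by
  by_contra! hne
  have hcard : ∀ k ≤ n, k ≤ (Jumps a b (Iter F k)).ncard := by
    intro k
    induction k with
    | zero => simp
    | succ k ih =>
      intro hk
      have hlt := ncard_lt_ncard
        ((hF.monotone_jumps_iter k.le_succ).ssubset_of_ne (hne k hk))
        (hfin.subset (hF.monotone_jumps_iter hk))
      have := ih (by lia)
      lia
  exact absurd (hcard n le_rfl) (by lia)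

theorem jumps_congr {a b : ℝ} {F G : ℝ → Set ℝ} (h : ∀ x ∈ Icc a b, F x = G x) :
    Jumps a b F = Jumps a b G := by
  ext x
  exact and_congr_right fun hx => by rw [h x hx]


/-- if `F ∈ 𝓕(I)` has finitely many jumps and intensity `ζ(F) > 1` (neither
`k = 0` nor `k = 1` satisfies `#J(F^k) = #J(F^{k+1})`), then `F` has no usc strictly
monotone iterative root in 𝓕(I) of any order `n > #J(F)`; in particular, if `F` has
exactly one jump then `F` has no such root of any order `n ≥ 2`. -/
theorem stmt19 (a b : ℝ) (hab : a < b) (F : ℝ → Set ℝ) (hF : ClassF a b F)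
    (hfin : (Jumps a b F).Finite)
    (hzeta : ∀ k : ℕ, k ≤ 1 →
      (Jumps a b (Iter F k)).ncard ≠ (Jumps a b (Iter F (k + 1))).ncard) :
    (∀ n : ℕ, (Jumps a b F).ncard < n →
      ¬ ∃ f : ℝ → Set ℝ, ClassF a b f ∧ ∀ x ∈ Icc a b, Iter f n x = F x) ∧
    ((Jumps a b F).ncard = 1 → ∀ n : ℕ, 2 ≤ n →
      ¬ ∃ f : ℝ → Set ℝ, ClassF a b f ∧ ∀ x ∈ Icc a b, Iter f n x = F x) := by
  have main : ∀ n : ℕ, (Jumps a b F).ncard < n →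
      ¬ ∃ f : ℝ → Set ℝ, ClassF a b f ∧ ∀ x ∈ Icc a b, Iter f n x = F x := by
    rintro n hn ⟨f, hf, hroot⟩
    have hJ : Jumps a b (Iter f n) = Jumps a b F := jumps_congr hroot
    have hsq : ∀ x ∈ Icc a b, Iter f (n + n) x = Iter F (1 + 1) x := by
      intro x hx
      rw [Iter_succ', Iter_add, hroot x hx]
      refine iUnion₂_congr fun y hy => ?_
      rw [Iter_one, hroot y ((hF.1 x hx).2.2 hy)]
    obtain ⟨j, hj, hstab⟩ := hf.exists_jumps_iter_eq_succ (hJ ▸ hfin) (hJ ▸ hn)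
    refine hzeta 1 le_rfl ?_
    rw [← jumps_congr hsq, jumps_congr fun x _ => Iter_one F x, ← hJ,
      hf.jumps_iter_eq_of_le hstab hj.le, hf.jumps_iter_eq_of_le hstab (by lia : j ≤ n + n)]
  exact ⟨main, fun h1 n hn => main n (by lia)⟩
end
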